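/- arXiv:2210.17350 — 12 statements merged into one kernel-verified Lean document; each statement's English description precedes it below -/
import Mathlib

section
/- Let (w_1, …, w_n) be a family of vectors in ℝⁿ and R > 0. Suppose that every vertex of the centrally symmetric parallelotope generated by the w_i lies on the sphere of radius R centered at the origin; that is, for every sign vector ε : Fin n → ℝ with ε i ∈ {1, -1} for all i, one has ‖∑_i ε i • w_i‖ = R. Then the family is orthogonal: ⟪w_i, w_j⟫ = 0 for all i ≠ j. -/
open scoped RealInnerProductSpace BigOperators

/-- If every vertex `±w₁ ± w₂ ± ⋯ ± wₙ` of a centrally symmetric parallelotope lies on the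
sphere of radius `R` centered at the origin, then the generating family is orthogonal. -/
theorem parallelotope_inscribed_in_sphere_orthogonal {n : ℕ}
    (w : Fin n → EuclideanSpace ℝ (Fin n)) (R : ℝ) (hR : 0 < R)
    (h : ∀ ε : Fin n → ℝ, (∀ i, ε i = 1 ∨ ε i = -1) → ‖∑ i, ε i • w i‖ = R) :
    ∀ i j, i ≠ j → ⟪w i, w j⟫ = 0 := by
  intro i j hij
  have key : ∀ s t : ℝ, (s = 1 ∨ s = -1) → (t = 1 ∨ t = -1) →
      ‖s • w i + (t • w j + ∑ k ∈ (Finset.univ.erase i).erase j, w k)‖ ^ 2 = R ^ 2 := by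
    intro s t hs ht
    rw [← h (fun k => if k = i then s else if k = j then t else 1)
      (by intro k; split_ifs <;> simp [hs, ht])]
    rw [← Finset.add_sum_erase _ _ (Finset.mem_univ i),
      ← Finset.add_sum_erase _ _ (Finset.mem_erase.mpr ⟨hij.symm, Finset.mem_univ j⟩)]
    have hsum : ∑ k ∈ (Finset.univ.erase i).erase j,
        (if k = i then s else if k = j then t else 1) • w k =
        ∑ k ∈ (Finset.univ.erase i).erase j, w k := by
      refine Finset.sum_congr rfl fun k hk => ?_
      simp only [Finset.mem_erase] at hk
      simp [hk.1, hk.2.1]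
    rw [hsum]
    simp [hij.symm]
  have h1 := key 1 1 (by simp) (by simp)
  have h2 := key 1 (-1) (by simp) (by simp)
  have h3 := key (-1) 1 (by simp) (by simp)
  have h4 := key (-1) (-1) (by simp) (by simp)
  simp only [norm_add_sq_real, inner_add_right, inner_smul_left, inner_smul_right, norm_smul,
    conj_trivial, norm_neg, norm_one] at h1 h2 h3 h4
  linarith
end

section
/- (Fuss, necessity.) Let A be a symmetric positive definite linear map on ℝⁿ. Suppose there exist an orthonormal basis (q_1, …, q_n) of ℝⁿ and positive reals ℓ_1, …, ℓ_n such that: (a) for every sign vector ε : Fin n → ℝ with ε i ∈ {1, -1}, the vertex ∑_i ε i • ℓ_i • q_i has norm 1 (the parallelotope is inscribed in the unit sphere), and (b) for every i, ℓ_i is the greatest element of {⟪A x, q_i⟫ : ‖x‖ = 1} (each face hyperplane {x : ⟪x, q_i⟫ = ℓ_i} is tangent to the inner ellipsoid A(S^{n-1})). Then tr(A ∘ A) = 1. -/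
open scoped RealInnerProductSpace BigOperators

/-- A positive greatest value of `⟪x, v⟫` over the unit sphere is the norm of `v`. -/
lemma eq_norm_of_isGreatest_inner {E : Type*} [NormedAddCommGroup E] [InnerProductSpace ℝ E]
    {v : E} {s : ℝ} (hs : 0 < s)
    (h : IsGreatest {r : ℝ | ∃ x : E, ‖x‖ = 1 ∧ r = ⟪x, v⟫} s) : s = ‖v‖ := by
  obtain ⟨⟨x, hx, rfl⟩, hub⟩ := h
  have hle : ⟪x, v⟫ ≤ ‖v‖ := by simpa [hx] using real_inner_le_norm x v
  have hv : ‖v‖ ≠ 0 := (hs.trans_le hle).ne'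
  refine hle.antisymm (hub ⟨‖v‖⁻¹ • v, ?_, ?_⟩)
  · rw [norm_smul, norm_inv, norm_norm, inv_mul_cancel₀ hv]
  · rw [real_inner_smul_left, real_inner_self_eq_norm_sq]
    field_simp

/-- Fuss, necessity: if some orthogonal parallelotope with directions `qᵢ` and half-edge
lengths `ℓᵢ` is inscribed in the unit sphere and each of its face hyperplanes is tangent to
the inner ellipsoid `A(Sⁿ⁻¹)`, then `tr (A ∘ A) = 1`. -/
theorem fuss_necessity {n : ℕ} (hn : 1 ≤ n)
    (A : EuclideanSpace ℝ (Fin n) →ₗ[ℝ] EuclideanSpace ℝ (Fin n))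
    (hsym : ∀ x y, ⟪A x, y⟫ = ⟪x, A y⟫)
    (hpos : ∀ x, x ≠ 0 → 0 < ⟪A x, x⟫)
    (q : OrthonormalBasis (Fin n) ℝ (EuclideanSpace ℝ (Fin n)))
    (ℓ : Fin n → ℝ) (hℓ : ∀ i, 0 < ℓ i)
    (hin : ∀ ε : Fin n → ℝ, (∀ i, ε i = 1 ∨ ε i = -1) →
      ‖∑ i, ε i • ℓ i • q i‖ = 1)
    (htan : ∀ i, IsGreatest
      {r : ℝ | ∃ x : EuclideanSpace ℝ (Fin n), ‖x‖ = 1 ∧ r = ⟪A x, q i⟫} (ℓ i)) :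
    LinearMap.trace ℝ (EuclideanSpace ℝ (Fin n)) (A ∘ₗ A) = 1 := by
  have hnorm : ∀ i, ℓ i = ‖A (q i)‖ := fun i ↦
    eq_norm_of_isGreatest_inner (hℓ i) (by simpa only [hsym] using htan i)
  have hsum : ∑ i, ℓ i ^ 2 = 1 := by
    have h := hin 1 fun _ ↦ Or.inl rfl
    simp only [Pi.one_apply, one_smul] at h
    have h' := q.orthonormal.inner_sum ℓ ℓ Finset.univ
    rw [real_inner_self_eq_norm_sq, h] at h'
    simpa [sq] using h'.symm
  rw [LinearMap.trace_eq_sum_inner _ q, ← hsum]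
  refine Finset.sum_congr rfl fun i _ ↦ ?_
  rw [LinearMap.comp_apply, ← hsym, real_inner_self_eq_norm_sq, hnorm]
end

section
/- (Fuss, sufficiency.) Let A be a symmetric positive definite linear map on ℝⁿ with tr(A ∘ A) = 1. Then for every orthonormal basis (q_1, …, q_n) of ℝⁿ, setting ℓ_i = ‖A q_i‖, the resulting orthogonal parallelotope fits tightly between the unit sphere and A(S^{n-1}): (a) for every sign vector ε : Fin n → ℝ with ε i ∈ {1, -1}, the vertex ∑_i ε i • ℓ_i • q_i has norm 1, and (b) for every i, ℓ_i is the greatest element of {⟪A x, q_i⟫ : ‖x‖ = 1}. -/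
open scoped RealInnerProductSpace BigOperators

/-- Fuss, sufficiency: if `tr (A ∘ A) = 1` then for every orthonormal basis `(qᵢ)`, the
orthogonal parallelotope with directions `qᵢ` and half-edge lengths `ℓᵢ = ‖A qᵢ‖` fits
tightly between the unit sphere and the inner ellipsoid `A(Sⁿ⁻¹)`. -/
theorem fuss_sufficiency {n : ℕ} (hn : 1 ≤ n)
    (A : EuclideanSpace ℝ (Fin n) →ₗ[ℝ] EuclideanSpace ℝ (Fin n))
    (hsym : ∀ x y, ⟪A x, y⟫ = ⟪x, A y⟫)
    (hpos : ∀ x, x ≠ 0 → 0 < ⟪A x, x⟫)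
    (htr : LinearMap.trace ℝ (EuclideanSpace ℝ (Fin n)) (A ∘ₗ A) = 1)
    (q : OrthonormalBasis (Fin n) ℝ (EuclideanSpace ℝ (Fin n))) :
    (∀ ε : Fin n → ℝ, (∀ i, ε i = 1 ∨ ε i = -1) →
      ‖∑ i, ε i • ‖A (q i)‖ • q i‖ = 1) ∧
    (∀ i, IsGreatest
      {r : ℝ | ∃ x : EuclideanSpace ℝ (Fin n), ‖x‖ = 1 ∧ r = ⟪A x, q i⟫} ‖A (q i)‖) := by
  have htrace : ∑ i, ‖A (q i)‖ ^ 2 = 1 := by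
    rw [← htr, LinearMap.trace_eq_sum_inner _ q]
    refine Finset.sum_congr rfl fun i _ => ?_
    rw [LinearMap.comp_apply, ← hsym, real_inner_self_eq_norm_sq]
  refine ⟨fun ε hε => ?_, fun i => ⟨?_, ?_⟩⟩
  · have hsq : ‖∑ i, ε i • ‖A (q i)‖ • q i‖ ^ 2 = 1 := by
      rw [← real_inner_self_eq_norm_sq]
      simp_rw [smul_smul]
      rw [q.orthonormal.inner_sum, ← htrace]
      refine Finset.sum_congr rfl fun i _ => ?_
      rcases hε i with h | h <;> simp [h, sq]
    exact (pow_eq_one_iff_of_nonneg (norm_nonneg _) two_ne_zero).mp hsq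
  · have hq : q i ≠ 0 := q.orthonormal.ne_zero i
    have hA : A (q i) ≠ 0 := fun h => by
      have := hpos _ hq
      simp [h] at this
    have hne : ‖A (q i)‖ ≠ 0 := norm_ne_zero_iff.mpr hA
    refine ⟨‖A (q i)‖⁻¹ • A (q i), by simp [norm_smul, hne], ?_⟩
    rw [hsym, real_inner_smul_left, real_inner_self_eq_norm_sq]
    field_simp
  · rintro r ⟨x, hx, rfl⟩
    rw [hsym]
    simpa [hx] using real_inner_le_norm x (A (q i))
end

section
/- (Fuss, bijectivity.) Let A be a symmetric positive definite linear map on ℝⁿ with tr(A ∘ A) = 1. Then for every orthonormal basis (q_1, …, q_n) of ℝⁿ there exists a unique function ℓ : Fin n → ℝ with all ℓ_i > 0 such that (a) for every sign vector ε : Fin n → ℝ with ε i ∈ {1, -1}, the point ∑_i ε i • ℓ_i • q_i has norm 1, and (b) for every i, ℓ_i is the greatest element of {⟪A x, q_i⟫ : ‖x‖ = 1}. In other words, each element of O(n) corresponds to exactly one labeled parallelotope fitting tightly between the unit sphere and A(S^{n-1}). -/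
open scoped RealInnerProductSpace BigOperators

/-- If `T` is symmetric and `T v ≠ 0`, the support function of the image of the unit sphere under
`T` in the direction `v` is attained and equals `‖T v‖`. -/
theorem LinearMap.IsSymmetric.isGreatest_inner_unit_sphere {E : Type*} [NormedAddCommGroup E]
    [InnerProductSpace ℝ E] {T : E →ₗ[ℝ] E} (hT : T.IsSymmetric) {v : E} (hv : T v ≠ 0) :
    IsGreatest {r : ℝ | ∃ x : E, ‖x‖ = 1 ∧ r = ⟪T x, v⟫} ‖T v‖ := by
  have hv' : ‖T v‖ ≠ 0 := norm_ne_zero_iff.mpr hv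
  constructor
  · refine ⟨‖T v‖⁻¹ • T v, norm_smul_inv_norm hv, ?_⟩
    rw [hT, real_inner_smul_left, real_inner_self_eq_norm_sq]
    field_simp
  · rintro r ⟨x, hx, rfl⟩
    simpa [hT x v, hx] using real_inner_le_norm x (T v)

/-- The sum of the squared norms of the images of an orthonormal basis under a symmetric map is
the trace of the square of the map. -/
theorem LinearMap.IsSymmetric.sum_norm_sq_eq_trace_comp_self {ι E : Type*} [Fintype ι]
    [NormedAddCommGroup E] [InnerProductSpace ℝ E] {T : E →ₗ[ℝ] E}
    (hT : T.IsSymmetric) (b : OrthonormalBasis ι ℝ E) :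
    ∑ i, ‖T (b i)‖ ^ 2 = LinearMap.trace ℝ E (T ∘ₗ T) := by
  rw [LinearMap.trace_eq_sum_inner _ b]
  exact Finset.sum_congr rfl fun i _ => by
    rw [← real_inner_self_eq_norm_sq, hT, LinearMap.comp_apply]

/-- Pythagoras for a linear combination of an orthonormal basis. -/
theorem OrthonormalBasis.norm_sq_sum_smul {ι E : Type*} [Fintype ι]
    [NormedAddCommGroup E] [InnerProductSpace ℝ E] (b : OrthonormalBasis ι ℝ E) (c : ι → ℝ) :
    ‖∑ i, c i • b i‖ ^ 2 = ∑ i, c i ^ 2 := by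
  rw [← real_inner_self_eq_norm_sq, b.orthonormal.inner_sum]
  simp [sq]

/-- Fuss, bijectivity: if `tr (A ∘ A) = 1` then every orthonormal basis `(qᵢ)` of `ℝⁿ`
is associated with exactly one vector of positive half-edge lengths `ℓ` producing a labeled
parallelotope fitting tightly between the unit sphere and `A(Sⁿ⁻¹)`. -/
theorem fuss_bijectivity {n : ℕ} (hn : 1 ≤ n)
    (A : EuclideanSpace ℝ (Fin n) →ₗ[ℝ] EuclideanSpace ℝ (Fin n))
    (hsym : ∀ x y, ⟪A x, y⟫ = ⟪x, A y⟫)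
    (hpos : ∀ x, x ≠ 0 → 0 < ⟪A x, x⟫)
    (htr : LinearMap.trace ℝ (EuclideanSpace ℝ (Fin n)) (A ∘ₗ A) = 1)
    (q : OrthonormalBasis (Fin n) ℝ (EuclideanSpace ℝ (Fin n))) :
    ∃! ℓ : Fin n → ℝ, (∀ i, 0 < ℓ i) ∧
      (∀ ε : Fin n → ℝ, (∀ i, ε i = 1 ∨ ε i = -1) →
        ‖∑ i, ε i • ℓ i • q i‖ = 1) ∧
      (∀ i, IsGreatest
        {r : ℝ | ∃ x : EuclideanSpace ℝ (Fin n), ‖x‖ = 1 ∧ r = ⟪A x, q i⟫} (ℓ i)) := by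
  have hA : A.IsSymmetric := hsym
  have hAq : ∀ i, A (q i) ≠ 0 := fun i h => by
    simpa [h] using hpos (q i) (q.orthonormal.ne_zero i)
  refine ⟨fun i => ‖A (q i)‖, ⟨fun i => norm_pos_iff.mpr (hAq i), fun ε hε => ?_,
    fun i => hA.isGreatest_inner_unit_sphere (hAq i)⟩, ?_⟩
  · have hε2 : ∀ i, ε i ^ 2 = 1 := fun i => by
      rcases hε i with h | h <;> simp [h]
    rw [← sq_eq_sq₀ (norm_nonneg _) zero_le_one]
    simp only [smul_smul]
    rw [q.norm_sq_sum_smul]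
    simp only [mul_pow, hε2, one_mul, one_pow]
    rw [hA.sum_norm_sq_eq_trace_comp_self q, htr]
  · rintro ℓ ⟨-, -, hℓ⟩
    exact funext fun i => (hℓ i).unique (hA.isGreatest_inner_unit_sphere (hAq i))
end

section
/- (Fuss for cross polytopes.) Let A be a symmetric positive definite linear map on ℝⁿ, let E_in be the unit sphere S^{n-1} and E_out = {v : ‖A v‖ = 1} (so that A maps E_out onto E_in). Then the following are equivalent: (i) there exists a linearly independent family (v_1, …, v_n) in ℝⁿ with ‖A v_i‖ = 1 for all i (the vertices ±v_i lie on E_out), such that for every sign vector ε : Fin n → ℝ with ε i ∈ {1, -1} there exists a unit vector w with ⟪ε i • v_i, w⟫ = 1 for all i (each face hyperplane of the cross polytope with vertices ±v_i is tangent to the unit sphere); (ii) tr(A ∘ A) = 1. -/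
open scoped RealInnerProductSpace

/-- The trace of `A ∘ A`, for symmetric `A`, is the sum of `‖A uᵢ‖ ^ 2` over any orthonormal
basis. -/
theorem trace_comp_self_eq_sum_norm_sq {ι E : Type*} [Fintype ι] [NormedAddCommGroup E]
    [InnerProductSpace ℝ E] (A : E →ₗ[ℝ] E) (hsym : ∀ x y, ⟪A x, y⟫ = ⟪x, A y⟫)
    (b : OrthonormalBasis ι ℝ E) :
    LinearMap.trace ℝ E (A ∘ₗ A) = ∑ i, ‖A (b i)‖ ^ 2 := by
  rw [LinearMap.trace_eq_sum_inner (A ∘ₗ A) b]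
  refine Finset.sum_congr rfl fun i _ => ?_
  rw [LinearMap.comp_apply, ← hsym, real_inner_self_eq_norm_sq]

/-- If all the hyperplanes `⟪εᵢ vᵢ, ·⟫ = 1` are tangent to the unit sphere, then the dual family of
`v` consists of pairwise orthogonal vectors. -/
theorem exists_orthogonal_dual_family {ι E : Type*} [NormedAddCommGroup E]
    [InnerProductSpace ℝ E] (b : Module.Basis ι ℝ E)
    (h : ∀ ε : ι → ℝ, (∀ i, ε i = 1 ∨ ε i = -1) →
      ∃ w : E, ‖w‖ = 1 ∧ ∀ i, ⟪ε i • b i, w⟫ = 1) :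
    ∃ (w : ι → E) (s : E), ‖s‖ = 1 ∧ (∀ i, ⟪w i, s⟫ = ‖w i‖ ^ 2) ∧
      (∀ i, ⟪b i, w i⟫ = 1) ∧ (∀ i j, i ≠ j → ⟪b i, w j⟫ = 0) ∧
      ∀ i j, i ≠ j → ⟪w i, w j⟫ = 0 := by
  classical
  have h' : ∀ ε : ι → ℝ, (∀ i, ε i = 1 ∨ ε i = -1) →
      ∃ w : E, ‖w‖ = 1 ∧ ∀ i, ⟪b i, w⟫ = ε i := by
    intro ε hε
    obtain ⟨w, hw, hw'⟩ := h ε hε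
    refine ⟨w, hw, fun i => ?_⟩
    have := hw' i
    rw [real_inner_smul_left] at this
    rcases hε i with h | h <;> rw [h] at this ⊢ <;> linarith
  obtain ⟨s, hs, hbs⟩ := h' (fun _ => 1) fun _ => Or.inl rfl
  have hflip : ∀ i, ∃ w : E, (∀ k, ⟪b k, w⟫ = if k = i then 1 else 0) ∧ ‖s - (2 : ℝ) • w‖ = 1 := by
    intro i
    obtain ⟨t, ht, hbt⟩ := h' (fun k => if k = i then -1 else 1) fun k => by
      by_cases hk : k = i <;> simp [hk]
    refine ⟨(1 / 2 : ℝ) • (s - t), fun k => ?_, ?_⟩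
    · rw [real_inner_smul_right, inner_sub_right, hbs, hbt]
      split_ifs <;> norm_num
    · rw [smul_smul]
      norm_num [ht]
  choose w hbw hsw using hflip
  have hws : ∀ i, ⟪w i, s⟫ = ‖w i‖ ^ 2 := by
    intro i
    have := norm_sub_sq_real s ((2 : ℝ) • w i)
    rw [hsw, hs, real_inner_smul_right, norm_smul, real_inner_comm, mul_pow] at this
    norm_num at this
    linarith
  refine ⟨w, s, hs, hws, fun i => by simp [hbw], fun i j hij => by simp [hbw, hij],
    fun i j hij => ?_⟩
  obtain ⟨t, ht, hbt⟩ := h' (fun k => if k = i ∨ k = j then -1 else 1) fun k => by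
    by_cases hk : k = i ∨ k = j <;> simp [hk]
  have hst : t = s - (2 : ℝ) • (w i + w j) := by
    refine InnerProductSpace.ext_inner_left_basis (𝕜 := ℝ) b fun k => ?_
    rw [inner_sub_right, real_inner_smul_right, inner_add_right, hbt, hbs, hbw, hbw]
    by_cases hi : k = i
    · have : k ≠ j := fun hj => hij (hi.symm.trans hj)
      simp [hi, hij]; norm_num
    · by_cases hj : k = j <;> simp [hi, hj, hij.symm]; norm_num
  have h1 := norm_sub_sq_real s ((2 : ℝ) • (w i + w j))
  have h2 := norm_add_sq_real (w i) (w j)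
  rw [← hst, ht, hs, real_inner_smul_right, norm_smul, real_inner_comm, mul_pow, inner_add_left,
    hws, hws] at h1
  norm_num at h1
  linarith

/-- Fuss for cross polytopes: a centrally symmetric cross polytope with vertices `±vᵢ` on the
outer ellipsoid `E_out = {v : ‖A v‖ = 1}` and all hyperfaces tangent to the unit sphere exists
if and only if `tr (A ∘ A) = 1`. -/
theorem fuss_cross_polytopes {n : ℕ} (hn : 1 ≤ n)
    (A : EuclideanSpace ℝ (Fin n) →ₗ[ℝ] EuclideanSpace ℝ (Fin n))
    (hsym : ∀ x y, ⟪A x, y⟫ = ⟪x, A y⟫)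
    (hpos : ∀ x, x ≠ 0 → 0 < ⟪A x, x⟫) :
    (∃ v : Fin n → EuclideanSpace ℝ (Fin n), LinearIndependent ℝ v ∧
      (∀ i, ‖A (v i)‖ = 1) ∧
      (∀ ε : Fin n → ℝ, (∀ i, ε i = 1 ∨ ε i = -1) →
        ∃ w : EuclideanSpace ℝ (Fin n), ‖w‖ = 1 ∧ ∀ i, ⟪ε i • v i, w⟫ = 1)) ↔
    LinearMap.trace ℝ (EuclideanSpace ℝ (Fin n)) (A ∘ₗ A) = 1 := by
  constructor
  · rintro ⟨v, hv, hAv, h⟩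
    have : Nonempty (Fin n) := ⟨⟨0, hn⟩⟩
    obtain ⟨w, s, hs, hws, hvw, hvw', hw⟩ := exists_orthogonal_dual_family
      (basisOfLinearIndependentOfCardEqFinrank hv (by simp)) (by simpa using h)
    simp only [coe_basisOfLinearIndependentOfCardEqFinrank] at hvw hvw'
    have hw0 : ∀ i, ‖w i‖ ≠ 0 := fun i hi => by
      have := hvw i
      simp [norm_eq_zero.mp hi] at this
    have hu : Orthonormal ℝ fun i => ‖w i‖⁻¹ • w i := by
      refine ⟨fun i => ?_, fun i j hij => ?_⟩
      · simp [norm_smul, hw0 i]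
      · simp [real_inner_smul_left, real_inner_smul_right, hw i j hij]
    let u := (basisOfOrthonormalOfCardEqFinrank hu (by simp)).toOrthonormalBasis (by simpa using hu)
    have hui : ∀ i, u i = ‖w i‖⁻¹ • w i := fun i => by simp [u]
    have huv : ∀ i, u i = ‖w i‖ • v i := by
      intro i
      refine InnerProductSpace.ext_inner_left_basis (𝕜 := ℝ) u.toBasis fun j => ?_
      rw [u.coe_toBasis, u.inner_eq_ite, hui, real_inner_smul_left, real_inner_smul_right,
        real_inner_comm]
      split_ifs with hji
      · subst hji
        rw [hvw]
        field_simp [hw0 j]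
      · rw [hvw' i j (Ne.symm hji)]
        simp
    have hsum := u.sum_sq_inner_right s
    rw [trace_comp_self_eq_sum_norm_sq A hsym u]
    rw [hs, one_pow] at hsum
    rw [← hsum]
    refine Finset.sum_congr rfl fun i _ => ?_
    rw [huv, map_smul, norm_smul, hAv, ← huv, hui, real_inner_smul_left, hws, norm_norm]
    have := hw0 i
    field_simp
  · intro htr
    let u := EuclideanSpace.basisFun (Fin n) ℝ
    rw [trace_comp_self_eq_sum_norm_sq A hsym u] at htr
    have hA : ∀ i, ‖A (u i)‖ ≠ 0 := fun i hi => by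
      have := hpos (u i) (u.orthonormal.ne_zero i)
      simp [norm_eq_zero.mp hi] at this
    refine ⟨fun i => ‖A (u i)‖⁻¹ • u i, ?_, fun i => ?_, fun ε hε => ?_⟩
    · exact u.orthonormal.linearIndependent.units_smul fun i => (Units.mk0 _ (hA i))⁻¹
    · rw [map_smul, norm_smul, norm_inv, norm_norm, inv_mul_cancel₀ (hA i)]
    · have hε2 : ∀ i, ε i * ε i = 1 := fun i => by rcases hε i with h | h <;> simp [h]
      have hinner : ∀ i, ⟪u i, ∑ j, (ε j * ‖A (u j)‖) • u j⟫ = ε i * ‖A (u i)‖ := fun i =>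
        u.orthonormal.inner_right_fintype _ i
      refine ⟨∑ j, (ε j * ‖A (u j)‖) • u j, ?_, fun i => ?_⟩
      · rw [← sq_eq_sq₀ (norm_nonneg _) zero_le_one, one_pow, ← u.sum_sq_inner_right, ← htr]
        refine Finset.sum_congr rfl fun i _ => ?_
        rw [hinner, mul_pow, sq (ε i), hε2, one_mul]
      · rw [real_inner_smul_left, real_inner_smul_left, hinner]
        have := hA i
        field_simp
        rw [sq, hε2]
end

section
/- (Euler, necessity.) Let A be a symmetric positive definite linear map on ℝⁿ, n ≥ 1. Suppose v : Fin (n+1) → ℝⁿ is a family of points with ‖A (v i)‖ ≤ 1 for all i (the vertices lie in the convex hull of the outer ellipsoid E_out = {v : ‖A v‖ = 1}) and the closed unit ball is contained in the convex hull of {v_1, …, v_{n+1}} (the simplex contains the inner ellipsoid E_in = S^{n-1}). Then tr A ≤ 1. -/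
open scoped RealInnerProductSpace

/-- The trace of an endomorphism, computed from the linear parts of barycentric coordinates. -/
theorem AffineBasis.trace_eq_sum_coord_linear {ι E : Type*} [Fintype ι] [AddCommGroup E]
    [Module ℝ E] [FiniteDimensional ℝ E] (b : AffineBasis ι ℝ E) (A : E →ₗ[ℝ] E) :
    LinearMap.trace ℝ E A = ∑ i, (b.coord i).linear (A (b i)) := by
  have hA : A = ∑ i, (b.coord i).linear.smulRight (A (b i)) := by
    ext x
    have hx : x = ∑ i, (b.coord i).linear x • b i := by
      have hlin (i : ι) : (b.coord i).linear x = b.coord i x - b.coord i 0 := by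
        simpa using (b.coord i).linearMap_vsub x 0
      simp_rw [hlin, sub_smul, Finset.sum_sub_distrib, b.linear_combination_coord_eq_self,
        sub_zero]
    conv_lhs => rw [hx]
    simp
  conv_lhs => rw [hA]
  simp [LinearMap.trace_smulRight]

/-- If a simplex contains the closed unit ball, then any linear map sending its vertices
into the closed unit ball has trace at most `1`. -/
theorem AffineBasis.trace_le_one {ι E : Type*} [Fintype ι] [NormedAddCommGroup E]
    [NormedSpace ℝ E] [FiniteDimensional ℝ E] (b : AffineBasis ι ℝ E) (A : E →ₗ[ℝ] E)
    (hvert : ∀ i, ‖A (b i)‖ ≤ 1)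
    (hball : Metric.closedBall (0 : E) 1 ⊆ convexHull ℝ (Set.range b)) :
    LinearMap.trace ℝ E A ≤ 1 := by
  rw [b.trace_eq_sum_coord_linear, ← b.sum_coord_apply_eq_one 0]
  refine Finset.sum_le_sum fun i _ => ?_
  have hmem : -A (b i) ∈ convexHull ℝ (Set.range b) := hball (by simpa using hvert i)
  rw [b.convexHull_eq_nonneg_coord] at hmem
  have hlin := (b.coord i).linearMap_vsub (-A (b i)) 0
  simp only [vsub_eq_sub, sub_zero, map_neg] at hlin
  linarith [hmem i]

/-- A set whose convex hull contains the closed unit ball spans the whole space affinely. -/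
theorem affineSpan_eq_top_of_closedBall_subset_convexHull {E : Type*} [NormedAddCommGroup E]
    [NormedSpace ℝ E] {s : Set E}
    (hball : Metric.closedBall (0 : E) 1 ⊆ convexHull ℝ s) : affineSpan ℝ s = ⊤ := by
  have hopen : affineSpan ℝ (Metric.ball (0 : E) 1) = ⊤ :=
    Metric.isOpen_ball.affineSpan_eq_top (Metric.nonempty_ball.2 one_pos)
  rw [← affineSpan_convexHull, eq_top_iff, ← hopen]
  exact affineSpan_mono ℝ (Metric.ball_subset_closedBall.trans hball)

/-- Euler, necessity: if a simplex with vertices `v₁, …, v_{n+1}` fits between the unit sphere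
`E_in = Sⁿ⁻¹` and the outer ellipsoid `E_out = {v : ‖A v‖ = 1}`, then `tr A ≤ 1`. -/
theorem euler_necessity {n : ℕ} (hn : 1 ≤ n)
    (A : EuclideanSpace ℝ (Fin n) →ₗ[ℝ] EuclideanSpace ℝ (Fin n))
    (hsym : ∀ x y, ⟪A x, y⟫ = ⟪x, A y⟫)
    (hpos : ∀ x, x ≠ 0 → 0 < ⟪A x, x⟫)
    (v : Fin (n + 1) → EuclideanSpace ℝ (Fin n))
    (hvert : ∀ i, ‖A (v i)‖ ≤ 1)
    (hball : Metric.closedBall (0 : EuclideanSpace ℝ (Fin n)) 1 ⊆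
      convexHull ℝ (Set.range v)) :
    LinearMap.trace ℝ (EuclideanSpace ℝ (Fin n)) A ≤ 1 := by
  have hspan := affineSpan_eq_top_of_closedBall_subset_convexHull hball
  have hind : AffineIndependent ℝ v := by
    rw [affineIndependent_iff_finrank_vectorSpan_eq ℝ v (Fintype.card_fin (n + 1)),
      ← direction_affineSpan, hspan, AffineSubspace.direction_top, finrank_top,
      finrank_euclideanSpace_fin]
  exact AffineBasis.trace_le_one ⟨v, hind, hspan⟩ A hvert hball
end

section
/- (Euler, existence of a tight simplex.) Let A be a symmetric positive definite linear map on ℝⁿ with tr A = 1, n ≥ 1. Then there exists a family v : Fin (n+1) → ℝⁿ such that ‖A (v i)‖ = 1 for all i and ⟪A (v i), v_j⟫ = -1 for all i ≠ j; that is, there exists a labeled simplex fitting tightly between the unit sphere E_in = S^{n-1} and the outer ellipsoid E_out = {v : ‖A v‖ = 1}. -/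
open scoped RealInnerProductSpace

section TracelessForm

variable {ι V : Type*} [AddCommGroup V] [Module ℝ V]

/-- Rotate the pair `v i`, `v j` of a family of vectors, leaving all other members fixed. -/
noncomputable def rotatePair [DecidableEq ι] (v : ι → V) (i j : ι) (θ : ℝ) : ι → V := fun k =>
  if k = i then Real.cos θ • v i + Real.sin θ • v j
  else if k = j then -Real.sin θ • v i + Real.cos θ • v j
  else v k

lemma rotatePair_orthonormal [DecidableEq ι] (g : V →ₗ[ℝ] V →ₗ[ℝ] ℝ) {v : ι → V}
    (hv : ∀ k l, g (v k) (v l) = if k = l then 1 else 0) {i j : ι} (hij : i ≠ j) (θ : ℝ) (k l : ι) :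
    g (rotatePair v i j θ k) (rotatePair v i j θ l) = if k = l then 1 else 0 := by
  have hcs := Real.sin_sq_add_cos_sq θ
  unfold rotatePair
  by_cases hki : k = i <;> by_cases hkj : k = j <;> by_cases hli : l = i <;>
    by_cases hlj : l = j <;>
    simp only [hki, hkj, hli, hlj, hij, hij.symm, if_true, if_false, map_add, map_smul,
      LinearMap.add_apply, LinearMap.smul_apply, smul_eq_mul, hv] <;> grind

lemma sum_rotatePair [Fintype ι] [DecidableEq ι] (Q : V →ₗ[ℝ] V →ₗ[ℝ] ℝ) (v : ι → V) {i j : ι}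
    (hij : i ≠ j) (θ : ℝ) :
    ∑ k, Q (rotatePair v i j θ k) (rotatePair v i j θ k) = ∑ k, Q (v k) (v k) := by
  have hcs := Real.sin_sq_add_cos_sq θ
  rw [← sub_eq_zero, ← Finset.sum_sub_distrib]
  rw [← Finset.sum_subset (Finset.subset_univ {i, j})]
  · rw [Finset.sum_pair hij]
    simp only [rotatePair, hij.symm, if_true, if_false, map_add, map_smul,
      LinearMap.add_apply, LinearMap.smul_apply, smul_eq_mul]
    linear_combination (Q (v i) (v i) + Q (v j) (v j)) * hcs
  · intro k _ hk
    simp only [Finset.mem_insert, Finset.mem_singleton, not_or] at hk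
    simp [rotatePair, hk.1, hk.2]

/-- If a bilinear form `Q` takes values of opposite sign at `v i` and `v j`, then some rotation of
this pair makes the first vector isotropic for `Q`. -/
lemma exists_rotatePair_isotropic [DecidableEq ι] (Q : V →ₗ[ℝ] V →ₗ[ℝ] ℝ) (v : ι → V) {i j : ι}
    (hi : 0 < Q (v i) (v i)) (hj : Q (v j) (v j) < 0) :
    ∃ θ, Q (rotatePair v i j θ i) (rotatePair v i j θ i) = 0 := by
  have hc : Continuous fun θ => Q (rotatePair v i j θ i) (rotatePair v i j θ i) := by
    simp only [rotatePair, if_true, map_add, map_smul, LinearMap.add_apply, LinearMap.smul_apply,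
      smul_eq_mul]
    fun_prop
  exact mem_range_of_exists_le_of_exists_ge hc
    ⟨Real.pi / 2, by simpa [rotatePair] using hj.le⟩ ⟨0, by simpa [rotatePair] using hi.le⟩

/-- A bilinear form `Q` whose trace along a `g`-orthonormal family vanishes has zero diagonal along
some `g`-orthonormal family. -/
theorem exists_orthonormal_isotropic [Fintype ι] [DecidableEq ι] (g Q : V →ₗ[ℝ] V →ₗ[ℝ] ℝ)
    (v : ι → V) (hv : ∀ k l, g (v k) (v l) = if k = l then 1 else 0)
    (hQ : ∑ k, Q (v k) (v k) = 0) :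
    ∃ w : ι → V, (∀ k l, g (w k) (w l) = if k = l then 1 else 0) ∧ ∀ k, Q (w k) (w k) = 0 := by
  induction hm : (Finset.univ.filter fun k => Q (v k) (v k) ≠ 0).card using Nat.strong_induction_on
    generalizing v with
  | _ m ih =>
    by_cases hz : ∀ k, Q (v k) (v k) = 0
    · exact ⟨v, hv, hz⟩
    push Not at hz
    obtain ⟨k₀, hk₀⟩ := hz
    obtain ⟨i, -, hi⟩ := Finset.exists_pos_of_sum_zero_of_exists_nonzero
      (fun k => Q (v k) (v k)) hQ ⟨k₀, Finset.mem_univ _, hk₀⟩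
    obtain ⟨j, -, hj⟩ := Finset.exists_pos_of_sum_zero_of_exists_nonzero
      (fun k => -Q (v k) (v k)) (by simpa using hQ) ⟨k₀, Finset.mem_univ _, neg_ne_zero.2 hk₀⟩
    have hj : Q (v j) (v j) < 0 := neg_pos.1 hj
    have hij : i ≠ j := by
      rintro rfl
      exact lt_asymm hi hj
    obtain ⟨θ, hθ⟩ := exists_rotatePair_isotropic Q v hi hj
    refine ih _ ?_ (rotatePair v i j θ) (rotatePair_orthonormal g hv hij θ)
      ((sum_rotatePair Q v hij θ).trans hQ) rfl
    rw [← hm]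
    refine Finset.card_lt_card (Finset.ssubset_iff_of_subset ?_ |>.2 ⟨i, ?_, ?_⟩)
    · intro k hk
      simp only [Finset.mem_filter, Finset.mem_univ, true_and] at hk ⊢
      by_cases hki : k = i
      · exact absurd (hki ▸ hθ) hk
      by_cases hkj : k = j
      · exact hkj ▸ hj.ne
      simpa [rotatePair, hki, hkj] using hk
    · simpa using hi.ne'
    · simpa using hθ

end TracelessForm

/-- Euler, existence: if `tr A = 1` there exists a labeled simplex fitting tightly between the
unit sphere `E_in = Sⁿ⁻¹` and the outer ellipsoid `E_out = {v : ‖A v‖ = 1}`. -/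
theorem euler_existence {n : ℕ} (hn : 1 ≤ n)
    (A : EuclideanSpace ℝ (Fin n) →ₗ[ℝ] EuclideanSpace ℝ (Fin n))
    (hsym : ∀ x y, ⟪A x, y⟫ = ⟪x, A y⟫)
    (hpos : ∀ x, x ≠ 0 → 0 < ⟪A x, x⟫)
    (htr : LinearMap.trace ℝ (EuclideanSpace ℝ (Fin n)) A = 1) :
    ∃ v : Fin (n + 1) → EuclideanSpace ℝ (Fin n),
      (∀ i, ‖A (v i)‖ = 1) ∧ ∀ i j, i ≠ j → ⟪A (v i), v j⟫ = -1 := by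
  have hS : A.IsSymmetric := hsym
  have hfr : Module.finrank ℝ (EuclideanSpace ℝ (Fin n)) = n := finrank_euclideanSpace_fin
  let b := hS.eigenvectorBasis hfr
  let μ := hS.eigenvalues hfr
  have hAb : ∀ k, A (b k) = μ k • b k := fun k => hS.apply_eigenvectorBasis hfr k
  have hbb : ∀ k l, ⟪b k, b l⟫ = if k = l then 1 else 0 := orthonormal_iff_ite.1 b.orthonormal
  have hμ : ∀ k, 0 < μ k := fun k => by
    have h := hpos (b k) (b.orthonormal.ne_zero k)
    rwa [hAb, real_inner_smul_left, hbb, if_pos rfl, mul_one] at h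
  have hμ_sum : ∑ k, μ k = 1 := by
    rw [← htr, LinearMap.trace_eq_sum_inner A b]
    simp [hAb, real_inner_smul_right]
  let fst := LinearMap.fst ℝ (EuclideanSpace ℝ (Fin n)) ℝ
  let snd := LinearMap.snd ℝ (EuclideanSpace ℝ (Fin n)) ℝ
  let g := (innerₗ (EuclideanSpace ℝ (Fin n))).compl₁₂ (A ∘ₗ fst) fst +
    (LinearMap.mul ℝ ℝ).compl₁₂ snd snd
  let Q := (innerₗ (EuclideanSpace ℝ (Fin n))).compl₁₂ (A ∘ₗ fst) (A ∘ₗ fst) -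
    (LinearMap.mul ℝ ℝ).compl₁₂ snd snd
  have hg : ∀ x y, g x y = ⟪A x.1, y.1⟫ + x.2 * y.2 := fun _ _ => rfl
  have hQ : ∀ x y, Q x y = ⟪A x.1, A y.1⟫ - x.2 * y.2 := fun _ _ => rfl
  let e : Fin (n + 1) → EuclideanSpace ℝ (Fin n) × ℝ :=
    Fin.cons (0, 1) fun k => ((√(μ k))⁻¹ • b k, 0)
  have hsq : ∀ k, √(μ k) * √(μ k) = μ k := fun k => Real.mul_self_sqrt (hμ k).le
  have hsq0 : ∀ k, √(μ k) ≠ 0 := fun k => (Real.sqrt_pos.2 (hμ k)).ne'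
  obtain ⟨w, hwg, hwQ⟩ := exists_orthonormal_isotropic g Q e
    (by
      intro k l
      rw [hg]
      refine Fin.cases ?_ (fun k => ?_) k <;> refine Fin.cases ?_ (fun l => ?_) l
      · simp [e]
      · simp [e, (Fin.succ_ne_zero l).symm]
      · simp [e]
      · simp only [e, Fin.cons_succ, map_smul, hAb, real_inner_smul_left, real_inner_smul_right,
          hbb, Fin.succ_inj]
        split_ifs with h
        · subst h
          have := hsq0 k
          field_simp
          linarith [hsq k]
        · simp)
    (by
      have hterm : ∀ k, Q (e (Fin.succ k)) (e (Fin.succ k)) = μ k := fun k => by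
        simp only [hQ, e, Fin.cons_succ, map_smul, hAb, real_inner_smul_left,
          real_inner_smul_right, hbb, if_true]
        have := hsq0 k
        field_simp
        linear_combination (-μ k) * hsq k
      rw [Fin.sum_univ_succ, Finset.sum_congr rfl fun k _ => hterm k, hμ_sum, hQ]
      simp [e])
  have hnorm : ∀ i, ‖A (w i).1‖ = |(w i).2| := fun i => by
    have h := hwQ i
    rw [hQ, real_inner_self_eq_norm_mul_norm, sub_eq_zero] at h
    rw [← abs_of_nonneg (norm_nonneg (A (w i).1))]
    exact abs_eq_abs.2 (mul_self_eq_mul_self_iff.1 h)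
  have hne : ∀ i, (w i).2 ≠ 0 := fun i h0 => by
    have hA : A (w i).1 = 0 := by simpa [h0] using hnorm i
    have h := hwg i i
    rw [hg, hA, h0] at h
    simp at h
  refine ⟨fun i => (w i).2⁻¹ • (w i).1, fun i => ?_, fun i j hij => ?_⟩
  · rw [map_smul, norm_smul, hnorm, Real.norm_eq_abs, abs_inv,
      inv_mul_cancel₀ (abs_ne_zero.2 (hne i))]
  · have h := hwg i j
    rw [hg, if_neg hij] at h
    rw [map_smul, real_inner_smul_left, real_inner_smul_right, eq_neg_of_add_eq_zero_left h]
    have := hne i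
    have := hne j
    field_simp
end

section
/- Let A : ℝⁿ → ℝⁿ be a symmetric positive definite linear map, n ≥ 1. Suppose v : Fin (n+1) → ℝⁿ satisfies ⟪A (v i), v_j⟫ = -1 for all i ≠ j (the lifted vectors (v_i, 1) ∈ ℝ^{n+1} are pairwise orthogonal for the inner product ⟪(x,s),(y,t)⟫_Â = ⟪A x, y⟫ + s t) and ‖A (v i)‖ = 1 for all i (each lifted vector lies on the lifted outer ellipsoid). Then tr A = 1. -/
open scoped RealInnerProductSpace

/-- Completeness relations for `n + 1` lifted vectors `(v i, 1)` that are orthogonal with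
respect to the form induced by a linear map `A` and have nonzero diagonal values. -/
theorem sum_inv_eq_of_inner_eq_neg_one {n : ℕ}
    (A : EuclideanSpace ℝ (Fin n) →ₗ[ℝ] EuclideanSpace ℝ (Fin n))
    (v : Fin (n + 1) → EuclideanSpace ℝ (Fin n))
    (horth : ∀ i j, i ≠ j → ⟪A (v i), v j⟫ = -1)
    (hd : ∀ i, ⟪A (v i), v i⟫ + 1 ≠ 0) :
    ∑ i, (⟪A (v i), v i⟫ + 1)⁻¹ = 1 ∧
      ∀ k l, ∑ i, (⟪A (v i), v i⟫ + 1)⁻¹ * A (v i) k * v i l = if k = l then 1 else 0 := by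
  let d : Fin (n + 1) → ℝ := fun i => ⟪A (v i), v i⟫ + 1
  let P : Matrix (Fin (n + 1)) (Fin n ⊕ Unit) ℝ :=
    Matrix.of fun i => Sum.elim (fun k => v i k) (fun _ => 1)
  let Q : Matrix (Fin n ⊕ Unit) (Fin (n + 1)) ℝ :=
    Matrix.of fun s i => (d i)⁻¹ * Sum.elim (fun k => A (v i) k) (fun _ => 1) s
  have hPQ : P * Q = 1 := by
    ext j i
    have h : (P * Q) j i = (d i)⁻¹ * (⟪A (v i), v j⟫ + 1) := by
      simp only [P, Q, Matrix.mul_apply, Fintype.sum_sum_type, Matrix.of_apply, Sum.elim_inl,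
        Sum.elim_inr, PiLp.inner_apply, mul_add, Finset.mul_sum]
      simp [mul_left_comm]
    rw [h, Matrix.one_apply]
    split_ifs with hji
    · subst hji
      exact inv_mul_cancel₀ (hd j)
    · rw [horth i j (Ne.symm hji)]
      simp
  have hQP : Q * P = 1 := (Matrix.mul_eq_one_comm_of_card_eq _ _ _ (by simp)).mp hPQ
  constructor
  · simpa [P, Q, d, Matrix.mul_apply] using congrFun₂ hQP (Sum.inr ()) (Sum.inr ())
  · intro k l
    simpa [P, Q, d, Matrix.mul_apply, Matrix.one_apply] using
      congrFun₂ hQP (Sum.inl k) (Sum.inl l)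

/-- If the `n+1` lifted vectors `(vᵢ, 1)` are pairwise orthogonal for the inner product induced
by `Â = A ⊕ 1` and each lies on the lifted outer ellipsoid (`‖A vᵢ‖ = 1`), then `tr A = 1`. -/
theorem trace_eq_one_of_orthogonal_on_ellipsoid {n : ℕ} (hn : 1 ≤ n)
    (A : EuclideanSpace ℝ (Fin n) →ₗ[ℝ] EuclideanSpace ℝ (Fin n))
    (hsym : ∀ x y, ⟪A x, y⟫ = ⟪x, A y⟫)
    (hpos : ∀ x, x ≠ 0 → 0 < ⟪A x, x⟫)
    (v : Fin (n + 1) → EuclideanSpace ℝ (Fin n))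
    (horth : ∀ i j, i ≠ j → ⟪A (v i), v j⟫ = -1)
    (hout : ∀ i, ‖A (v i)‖ = 1) :
    LinearMap.trace ℝ (EuclideanSpace ℝ (Fin n)) A = 1 := by
  have hd : ∀ i, ⟪A (v i), v i⟫ + 1 ≠ 0 := by
    intro i
    rcases eq_or_ne (v i) 0 with h | h
    · simp [h]
    · exact (add_pos (hpos _ h) one_pos).ne'
  obtain ⟨hsum, hres⟩ := sum_inv_eq_of_inner_eq_neg_one A v horth hd
  let e := EuclideanSpace.basisFun (Fin n) ℝ
  have hcoord : ∀ x k, A x k = ∑ l, A (e k) l * x l := by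
    intro x k
    have h := hsym (e k) x
    simp only [e, EuclideanSpace.basisFun_apply, EuclideanSpace.inner_single_left] at h ⊢
    simp only [PiLp.inner_apply] at h
    simpa [mul_comm] using h.symm
  have hnorm : ∀ i, ∑ k, A (v i) k * A (v i) k = 1 := by
    intro i
    have h := real_inner_self_eq_norm_sq (A (v i))
    rw [hout i, PiLp.inner_apply] at h
    simpa [← sq] using h
  calc LinearMap.trace ℝ (EuclideanSpace ℝ (Fin n)) A
      = ∑ k, A (e k) k := by
        rw [LinearMap.trace_eq_sum_inner A e]
        simp [e, EuclideanSpace.inner_single_left]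
    _ = ∑ k, ∑ l, A (e k) l * ∑ i, (⟪A (v i), v i⟫ + 1)⁻¹ * A (v i) k * v i l := by
        simp [hres]
    _ = ∑ i, (⟪A (v i), v i⟫ + 1)⁻¹ * ∑ k, A (v i) k * ∑ l, A (e k) l * v i l := by
        simp only [Finset.mul_sum]
        rw [Finset.sum_comm (s := Finset.univ (α := Fin (n + 1)))]
        refine Finset.sum_congr rfl fun k _ => ?_
        rw [Finset.sum_comm]
        refine Finset.sum_congr rfl fun i _ => Finset.sum_congr rfl fun l _ => ?_
        ring
    _ = 1 := by
        simp only [← hcoord, hnorm, mul_one, hsum]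
end

section
/- Let A : ℝⁿ → ℝⁿ be a symmetric positive definite linear map, n ≥ 1. Suppose v : Fin (n+1) → ℝⁿ satisfies ⟪A (v i), v_j⟫ = -1 for all i ≠ j. If ‖A (v i)‖ = 1 for all i ≠ n+1 (all but the last index) and ‖A (v_{n+1})‖ < 1 (the last point lies strictly inside the outer ellipsoid), then tr A < 1. -/
open scoped RealInnerProductSpace

/-- If a finite family `b`, of the size of the dimension, has dual functionals `φ i` up to nonzero
scalars `d i`, then the trace of `T` is `∑ i, φ i (T (b i)) / d i`. -/
lemma trace_eq_sum_div_of_biorthogonal {K V ι : Type*} [Field K] [AddCommGroup V] [Module K V]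
    [Fintype ι] [DecidableEq ι] [Nonempty ι] (b : ι → V) (φ : ι → V →ₗ[K] K) (d : ι → K)
    (hd : ∀ i, d i ≠ 0) (hφ : ∀ i j, φ i (b j) = if i = j then d i else 0)
    (hcard : Fintype.card ι = Module.finrank K V) (T : V →ₗ[K] V) :
    LinearMap.trace K V T = ∑ i, φ i (T (b i)) / d i := by
  have hli : LinearIndependent K b := by
    rw [Fintype.linearIndependent_iff]
    intro g hg i
    have h := congrArg (φ i) hg
    simpa [hφ, hd i] using h
  let B := basisOfLinearIndependentOfCardEqFinrank hli hcard
  have hB : ∀ i, B i = b i := fun i => by simp [B]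
  have hrepr : ∀ x i, B.repr x i = φ i x / d i := by
    intro x i
    rw [eq_div_iff (hd i)]
    conv_rhs => rw [← B.sum_repr x]
    simp [hB, hφ]
  rw [LinearMap.trace_eq_matrix_trace K B T, Matrix.trace]
  refine Finset.sum_congr rfl fun i _ => ?_
  rw [Matrix.diag_apply, LinearMap.toMatrix_apply, hrepr, hB]

/-- If the `n+1` lifted vectors `(vᵢ, 1)` are pairwise orthogonal for the inner product induced
by `Â = A ⊕ 1`, all but the last point lie on the outer ellipsoid (`‖A vᵢ‖ = 1`) and the last
point lies strictly inside it, then `tr A < 1`. -/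
theorem trace_lt_one_of_orthogonal_last_inside {n : ℕ} (hn : 1 ≤ n)
    (A : EuclideanSpace ℝ (Fin n) →ₗ[ℝ] EuclideanSpace ℝ (Fin n))
    (hsym : ∀ x y, ⟪A x, y⟫ = ⟪x, A y⟫)
    (hpos : ∀ x, x ≠ 0 → 0 < ⟪A x, x⟫)
    (v : Fin (n + 1) → EuclideanSpace ℝ (Fin n))
    (horth : ∀ i j, i ≠ j → ⟪A (v i), v j⟫ = -1)
    (hout : ∀ i, i ≠ Fin.last n → ‖A (v i)‖ = 1)
    (hlast : ‖A (v (Fin.last n))‖ < 1) :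
    LinearMap.trace ℝ (EuclideanSpace ℝ (Fin n)) A < 1 := by
  let φ : Fin (n + 1) → (EuclideanSpace ℝ (Fin n) × ℝ) →ₗ[ℝ] ℝ := fun i =>
    (innerₗ _ (A (v i))).coprod LinearMap.id
  let d : Fin (n + 1) → ℝ := fun i => ⟪A (v i), v i⟫ + 1
  have hd : ∀ i, 0 < d i := by
    intro i
    have h : 0 ≤ ⟪A (v i), v i⟫ := by
      rcases eq_or_ne (v i) 0 with h | h
      · simp [h]
      · exact (hpos _ h).le
    positivity
  have hφ : ∀ i j, φ i (v j, 1) = if i = j then d i else 0 := by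
    intro i j
    split_ifs with h
    · subst h; simp [φ, d]
    · simp [φ, horth i j h]
  have htrace := trace_eq_sum_div_of_biorthogonal (fun i => (v i, (1 : ℝ))) φ d
    (fun i => (hd i).ne') hφ (by simp)
  have hA := htrace (A.prodMap 0)
  have hone := htrace (LinearMap.prodMap 0 LinearMap.id)
  rw [LinearMap.trace_prodMap'] at hA hone
  simp only [map_zero, add_zero, zero_add, LinearMap.trace_id, Module.finrank_self, Nat.cast_one,
    φ, LinearMap.prodMap_apply, LinearMap.coprod_apply, LinearMap.zero_apply, LinearMap.id_apply,
    innerₗ_apply_apply, real_inner_self_eq_norm_sq] at hA hone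
  rw [hA, hone]
  refine Finset.sum_lt_sum (fun i _ => ?_) ⟨Fin.last n, Finset.mem_univ _, ?_⟩
  · have hle : ‖A (v i)‖ ≤ 1 := by
      rcases eq_or_ne i (Fin.last n) with rfl | h
      · exact hlast.le
      · exact (hout i h).le
    exact div_le_div_of_nonneg_right (pow_le_one₀ (norm_nonneg _) hle) (hd i).le
  · exact div_lt_div_of_pos_right (pow_lt_one₀ (norm_nonneg _) hlast two_ne_zero) (hd _)
end

section
/- Let A : ℝⁿ → ℝⁿ be a symmetric positive definite linear map, n ≥ 1. For a nonzero subspace W of ℝⁿ, let A_W : W → W denote the unique positive semidefinite self-adjoint operator on W whose square is the compression of A² to W, i.e. ⟪A_W² x, x⟫ = ‖A x‖² for all x ∈ W (equivalently A_W is the positive square root of P_W ∘ A² restricted to W, where P_W is the orthogonal projection onto W); A_W is the unique positive symmetric map of W carrying the ellipsoid {x ∈ W : ‖A x‖ = 1} to the unit sphere of W. If W₁ and W₂ are nonzero subspaces with W₁ strictly contained in W₂, then tr A_{W₁} < tr A_{W₂}. -/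
open scoped RealInnerProductSpace

section

variable {E F : Type*} [NormedAddCommGroup E] [InnerProductSpace ℝ E] [FiniteDimensional ℝ E]
  [NormedAddCommGroup F] [InnerProductSpace ℝ F] [FiniteDimensional ℝ F]

/-- The eigenvalues of an injective positive operator are positive. -/
theorem LinearMap.IsPositive.eigenvalues_pos_of_injective {T : E →ₗ[ℝ] E} (hT : T.IsPositive)
    (hinj : Function.Injective T) (i : Fin (Module.finrank ℝ E)) :
    0 < hT.isSymmetric.eigenvalues rfl i := by
  refine lt_of_le_of_ne (hT.nonneg_eigenvalues rfl i) fun h => ?_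
  have happ := hT.isSymmetric.apply_eigenvectorBasis rfl i
  rw [← h] at happ
  refine (hT.isSymmetric.eigenvectorBasis rfl).orthonormal.ne_zero i (hinj ?_)
  simpa using happ

/-- The trace of an injective positive operator strictly exceeds the sum of its diagonal entries
along an orthonormal family that is too small to be a basis. -/
theorem Orthonormal.sum_inner_lt_trace {ι : Type*} [Fintype ι] {f : ι → E}
    (hf : Orthonormal ℝ f) {T : E →ₗ[ℝ] E} (hT : T.IsPositive) (hinj : Function.Injective T)
    (hcard : Fintype.card ι < Module.finrank ℝ E) :
    ∑ j, ⟪T (f j), f j⟫ < LinearMap.trace ℝ E T := by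
  set e := hT.isSymmetric.eigenvectorBasis rfl
  set μ := hT.isSymmetric.eigenvalues rfl
  have happ : ∀ i, T (e i) = μ i • e i := fun i => hT.isSymmetric.apply_eigenvectorBasis rfl i
  have hμ : ∀ i, 0 < μ i := fun i => hT.eigenvalues_pos_of_injective hinj i
  have hdiag : ∀ x, ⟪T x, x⟫ = ∑ i, μ i * ⟪x, e i⟫ ^ 2 := fun x => by
    rw [← e.sum_inner_mul_inner]
    refine Finset.sum_congr rfl fun i _ => ?_
    rw [hT.isSymmetric x (e i), happ, inner_smul_right, real_inner_comm x (e i)]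
    ring
  have htrace : LinearMap.trace ℝ E T = ∑ i, μ i := by
    rw [T.trace_eq_sum_inner e]
    refine Finset.sum_congr rfl fun i _ => ?_
    rw [happ, inner_smul_right, real_inner_self_eq_norm_sq, e.norm_eq_one]
    ring
  have hbessel : ∀ i, ∑ j, ⟪f j, e i⟫ ^ 2 ≤ 1 := fun i => by
    simpa using hf.sum_inner_products_le (e i) (s := Finset.univ)
  have hparseval : ∑ i, ∑ j, ⟪f j, e i⟫ ^ 2 = (Fintype.card ι : ℝ) := by
    rw [Finset.sum_comm]
    simp [e.sum_sq_inner_left, hf.norm_eq_one]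
  obtain ⟨i₀, hi₀⟩ : ∃ i, ∑ j, ⟪f j, e i⟫ ^ 2 < 1 := by
    by_contra! h
    have := Finset.sum_le_sum fun i (_ : i ∈ Finset.univ) => h i
    rw [hparseval] at this
    simp only [Finset.sum_const, Finset.card_univ, Fintype.card_fin, nsmul_eq_mul,
      mul_one, Nat.cast_le] at this
    omega
  simp_rw [htrace, hdiag]
  rw [Finset.sum_comm]
  simp_rw [← Finset.mul_sum]
  exact Finset.sum_lt_sum (fun i _ => mul_le_of_le_one_right (hμ i).le (hbessel i))
    ⟨i₀, Finset.mem_univ _, mul_lt_of_lt_one_right (hμ i₀) hi₀⟩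

/-- If `S` and `T` are positive, `T` is injective and `S ^ 2` is the compression of `T ^ 2` along
an isometric embedding into a space of larger dimension, then `tr S < tr T`. -/
theorem LinearMap.IsPositive.trace_lt_trace_of_norm_apply_eq {S : E →ₗ[ℝ] E} {T : F →ₗ[ℝ] F}
    (hS : S.IsPositive) (hT : T.IsPositive) (hinj : Function.Injective T) (J : E →ₗᵢ[ℝ] F)
    (hnorm : ∀ x, ‖T (J x)‖ = ‖S x‖) (hrank : Module.finrank ℝ E < Module.finrank ℝ F) :
    LinearMap.trace ℝ E S < LinearMap.trace ℝ F T := by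
  have hSinj : Function.Injective S := (injective_iff_map_eq_zero S).2 fun x hx => by
    have h := hnorm x
    rw [hx, norm_zero, norm_eq_zero] at h
    exact J.injective (hinj (by simpa using h))
  have hinner : ∀ x y, ⟪T (J x), T (J y)⟫ = ⟪S x, S y⟫ := fun x y => by
    simp only [real_inner_eq_norm_add_mul_self_sub_norm_mul_self_sub_norm_mul_self_div_two,
      ← map_add, hnorm]
  set e := hS.isSymmetric.eigenvectorBasis rfl
  set μ := hS.isSymmetric.eigenvalues rfl
  have happ : ∀ i, S (e i) = μ i • e i := fun i => hS.isSymmetric.apply_eigenvectorBasis rfl i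
  have hμ : ∀ i, 0 < μ i := fun i => hS.eigenvalues_pos_of_injective hSinj i
  have hf : Orthonormal ℝ fun i => J (e i) := e.orthonormal.comp_linearIsometry J
  have hg : Orthonormal ℝ fun i => (μ i)⁻¹ • T (J (e i)) := by
    classical
    rw [orthonormal_iff_ite]
    intro i j
    simp only [inner_smul_left, inner_smul_right, hinner, happ, orthonormal_iff_ite.1 e.orthonormal,
      RCLike.conj_to_real]
    split_ifs with hij
    · subst hij
      field_simp [(hμ i).ne']
    · simp
  have htrace : LinearMap.trace ℝ E S = ∑ i, ⟪T (J (e i)), (μ i)⁻¹ • T (J (e i))⟫ := by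
    rw [S.trace_eq_sum_inner e]
    refine Finset.sum_congr rfl fun i _ => ?_
    rw [inner_smul_right, hinner, happ]
    simp only [inner_smul_left, inner_smul_right, RCLike.conj_to_real]
    field_simp [(hμ i).ne']
  have hamgm : ∀ x y, 2 * ⟪T x, y⟫ ≤ ⟪T x, x⟫ + ⟪T y, y⟫ := fun x y => by
    have h : 0 ≤ ⟪T (x - y), x - y⟫ := hT.inner_nonneg_left (x - y)
    have hyx : ⟪T y, x⟫ = ⟪T x, y⟫ := by rw [hT.isSymmetric y x, real_inner_comm]
    rw [map_sub, inner_sub_left, inner_sub_right, inner_sub_right, hyx] at h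
    linarith
  have hsum := Finset.sum_le_sum fun i (_ : i ∈ Finset.univ) =>
    hamgm (J (e i)) ((μ i)⁻¹ • T (J (e i)))
  rw [← Finset.mul_sum, Finset.sum_add_distrib, ← htrace] at hsum
  have hlt₁ := hf.sum_inner_lt_trace hT hinj (by simpa using hrank)
  have hlt₂ := hg.sum_inner_lt_trace hT hinj (by simpa using hrank)
  linarith

end

/-- Monotonicity of `tr A_W`: for nonzero subspaces `W₁ ⊊ W₂`, if `B₁` and `B₂` are the
positive self-adjoint operators on `W₁` and `W₂` characterized by
`⟪Bᵢ (Bᵢ x), x⟫ = ‖A x‖²` (i.e. `Bᵢ` is the positive square root of the compression of `A²`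
to `Wᵢ`, the unique positive symmetric map carrying `{x ∈ Wᵢ : ‖A x‖ = 1}` to the unit sphere
of `Wᵢ`), then `tr B₁ < tr B₂`. -/
theorem trace_compression_strict_mono {n : ℕ} (hn : 1 ≤ n)
    (A : EuclideanSpace ℝ (Fin n) →ₗ[ℝ] EuclideanSpace ℝ (Fin n))
    (hsym : ∀ x y, ⟪A x, y⟫ = ⟪x, A y⟫)
    (hpos : ∀ x, x ≠ 0 → 0 < ⟪A x, x⟫)
    (W₁ W₂ : Submodule ℝ (EuclideanSpace ℝ (Fin n)))
    (hW₁ : W₁ ≠ ⊥) (hlt : W₁ < W₂)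
    (B₁ : W₁ →ₗ[ℝ] W₁) (B₂ : W₂ →ₗ[ℝ] W₂)
    (hB₁sym : ∀ x y : W₁, ⟪B₁ x, y⟫ = ⟪x, B₁ y⟫)
    (hB₁pos : ∀ x : W₁, 0 ≤ ⟪B₁ x, x⟫)
    (hB₁sq : ∀ x : W₁, ⟪B₁ (B₁ x), x⟫ = ‖A (x : EuclideanSpace ℝ (Fin n))‖ ^ 2)
    (hB₂sym : ∀ x y : W₂, ⟪B₂ x, y⟫ = ⟪x, B₂ y⟫)
    (hB₂pos : ∀ x : W₂, 0 ≤ ⟪B₂ x, x⟫)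
    (hB₂sq : ∀ x : W₂, ⟪B₂ (B₂ x), x⟫ = ‖A (x : EuclideanSpace ℝ (Fin n))‖ ^ 2) :
    LinearMap.trace ℝ W₁ B₁ < LinearMap.trace ℝ W₂ B₂ := by
  have hnorm₁ : ∀ x : W₁, ‖B₁ x‖ = ‖A x‖ := fun x => by
    rw [← sq_eq_sq₀ (norm_nonneg _) (norm_nonneg _), ← hB₁sq x, hB₁sym,
      real_inner_self_eq_norm_sq]
  have hnorm₂ : ∀ x : W₂, ‖B₂ x‖ = ‖A x‖ := fun x => by
    rw [← sq_eq_sq₀ (norm_nonneg _) (norm_nonneg _), ← hB₂sq x, hB₂sym,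
      real_inner_self_eq_norm_sq]
  have hinj : Function.Injective B₂ := (injective_iff_map_eq_zero B₂).2 fun x hx => by
    have h := hnorm₂ x
    rw [hx, norm_zero, eq_comm, norm_eq_zero] at h
    by_contra hne
    have := hpos x (by simpa using hne)
    simp [h] at this
  let J : W₁ →ₗᵢ[ℝ] W₂ := ⟨Submodule.inclusion hlt.le, fun _ => rfl⟩
  exact LinearMap.IsPositive.trace_lt_trace_of_norm_apply_eq ⟨hB₁sym, hB₁pos⟩ ⟨hB₂sym, hB₂pos⟩
    hinj J (fun x => (hnorm₂ (J x)).trans (hnorm₁ x).symm) (Submodule.finrank_lt_finrank_of_lt hlt)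
end

section
/- Let A : ℝⁿ → ℝⁿ be a symmetric positive definite linear map with tr A ≤ 1, n ≥ 1, and let i ≤ n. Suppose v : Fin i → ℝⁿ satisfies ‖A (v j)‖ = 1 for all j and ⟪A (v j), v_k⟫ = -1 for all j ≠ k. Then the family (v_1, …, v_i) is linearly independent. -/
open scoped RealInnerProductSpace

/-- A linearly dependent family whose lifts `(vⱼ, 1)` are pairwise orthogonal admits a vanishing
affine combination, whose coefficients are the inverse squared lengths of the lifts. -/
theorem exists_normalized_relation {ι E : Type*} [Fintype ι] [NormedAddCommGroup E]
    [InnerProductSpace ℝ E] (A : E →ₗ[ℝ] E) (v : ι → E)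
    (hnonneg : ∀ j, 0 ≤ ⟪A (v j), v j⟫)
    (horth : ∀ j k, j ≠ k → ⟪A (v j), v k⟫ = -1)
    (hdep : ¬ LinearIndependent ℝ v) :
    ∃ c : ι → ℝ, (∀ j, c j * (⟪A (v j), v j⟫ + 1) = 1) ∧
      ∑ j, c j = 1 ∧ ∑ j, c j • v j = 0 := by
  classical
  obtain ⟨d, hd, k₀, hk₀⟩ := Fintype.not_linearIndependent_iff.1 hdep
  have hmul : ∀ k, d k * (⟪A (v k), v k⟫ + 1) = ∑ j, d j := by
    intro k
    have h : ⟪A (∑ j, d j • v j), v k⟫ = 0 := by simp [hd]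
    have hterm : ∀ j, d j * ⟪A (v j), v k⟫ =
        (if j = k then d k * (⟪A (v k), v k⟫ + 1) else 0) - d j := by
      intro j
      by_cases hjk : j = k
      · subst hjk
        rw [if_pos rfl]
        ring
      · simp [hjk, horth j k hjk]
    simp only [map_sum, map_smul, sum_inner, real_inner_smul_left, hterm,
      Finset.sum_sub_distrib, Finset.sum_ite_eq', Finset.mem_univ, if_true] at h
    linarith
  have hs : ∑ j, d j ≠ 0 := by
    rw [← hmul k₀]
    exact mul_ne_zero hk₀ (by linarith [hnonneg k₀])
  refine ⟨fun j => d j / ∑ l, d l, fun j => ?_, ?_, ?_⟩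
  · rw [div_mul_eq_mul_div, hmul, div_self hs]
  · rw [← Finset.sum_div, div_self hs]
  · simp only [div_eq_inv_mul, mul_smul, ← Finset.smul_sum, hd, smul_zero]

/-- If `tr A ≤ 1` and the `i ≤ n` lifted vectors `(vⱼ, 1)` are pairwise orthogonal for the
inner product induced by `Â = A ⊕ 1`, with each `vⱼ` on the outer ellipsoid, then the family
`(v₁, …, vᵢ)` is linearly independent. -/
theorem linearIndependent_of_orthogonal_lifts {n : ℕ} (hn : 1 ≤ n)
    (A : EuclideanSpace ℝ (Fin n) →ₗ[ℝ] EuclideanSpace ℝ (Fin n))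
    (hsym : ∀ x y, ⟪A x, y⟫ = ⟪x, A y⟫)
    (hpos : ∀ x, x ≠ 0 → 0 < ⟪A x, x⟫)
    (htr : LinearMap.trace ℝ (EuclideanSpace ℝ (Fin n)) A ≤ 1)
    (i : ℕ) (hi : i ≤ n)
    (v : Fin i → EuclideanSpace ℝ (Fin n))
    (hout : ∀ j, ‖A (v j)‖ = 1)
    (horth : ∀ j k, j ≠ k → ⟪A (v j), v k⟫ = -1) :
    LinearIndependent ℝ v := by
  classical
  have inner_nonneg : ∀ x, 0 ≤ ⟪A x, x⟫ := fun x => by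
    by_cases hx : x = 0
    · simp [hx]
    · exact (hpos x hx).le
  by_contra hdep
  obtain ⟨c, hc, hcsum⟩ := exists_normalized_relation A v (fun j => inner_nonneg (v j)) horth hdep
  have hfix : ∀ k, ∑ j, (c j * ⟪A (v j), v k⟫) • v j = v k := by
    intro k
    have hterm : ∀ j, (c j * ⟪A (v j), v k⟫) • v j = (if j = k then v k else 0) - c j • v j := by
      intro j
      by_cases hjk : j = k
      · subst hjk
        have h := hc j
        rw [if_pos rfl, eq_sub_iff_add_eq, ← add_smul]
        rw [show c j * ⟪A (v j), v j⟫ + c j = 1 by linarith, one_smul]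
      · simp [hjk, horth j k hjk]
    simp [hterm, Finset.sum_sub_distrib, hcsum.2]
  let T : EuclideanSpace ℝ (Fin n) → EuclideanSpace ℝ (Fin n) :=
    fun x => ∑ j, (c j * ⟪A (v j), x⟫) • v j
  have hAv : ∀ x k, ⟪A (x - T x), v k⟫ = 0 := by
    intro x k
    have h : ⟪A (T x), v k⟫ = ⟪A x, v k⟫ := by
      calc ⟪A (T x), v k⟫ = ∑ j, c j * ⟪A (v j), x⟫ * ⟪A (v j), v k⟫ := by
            simp [T, map_sum, sum_inner, real_inner_smul_left]
        _ = ⟪A x, ∑ j, (c j * ⟪A (v j), v k⟫) • v j⟫ := by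
            rw [inner_sum]
            refine Finset.sum_congr rfl fun j _ => ?_
            rw [real_inner_smul_right, hsym x, real_inner_comm x]
            ring
        _ = ⟪A x, v k⟫ := by rw [hfix]
    rw [map_sub, inner_sub_left, h, sub_self]
  have hquad : ∀ x, ⟪A (x - T x), x⟫ = ⟪A (x - T x), x - T x⟫ := by
    intro x
    have h : ⟪A (x - T x), T x⟫ = 0 := by
      change ⟪A (x - T x), ∑ j, (c j * ⟪A (v j), x⟫) • v j⟫ = 0
      simp only [inner_sum, real_inner_smul_right, hAv, mul_zero, Finset.sum_const_zero]
    rw [inner_sub_right, h, sub_zero]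
  let e := EuclideanSpace.basisFun (Fin n) ℝ
  have htrT : ∑ k, ⟪A (T (e k)), e k⟫ = 1 := by
    calc ∑ k, ⟪A (T (e k)), e k⟫
        = ∑ k, ∑ j, c j * (⟪A (v j), e k⟫ * ⟪e k, A (v j)⟫) := by
          refine Finset.sum_congr rfl fun k _ => ?_
          simp only [T, map_sum, map_smul, sum_inner, real_inner_smul_left]
          refine Finset.sum_congr rfl fun j _ => ?_
          rw [real_inner_comm (A (v j)) (e k)]
          ring
      _ = ∑ j, c j * ⟪A (v j), A (v j)⟫ := by
          rw [Finset.sum_comm]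
          simp only [← Finset.mul_sum, e.sum_inner_mul_inner]
      _ = 1 := by simp [hout, hcsum.1]
  have hsum : ∑ k, ⟪A (e k - T (e k)), e k⟫ ≤ 0 := by
    rw [LinearMap.trace_eq_sum_inner A e] at htr
    simp only [map_sub, inner_sub_left, Finset.sum_sub_distrib, htrT]
    simp only [real_inner_comm] at htr ⊢
    linarith
  have hnonneg : ∀ k ∈ Finset.univ, 0 ≤ ⟪A (e k - T (e k)), e k⟫ := fun k _ => by
    rw [hquad]
    exact inner_nonneg _
  have hTe : ∀ k, e k = T (e k) := by
    intro k
    have h0 := (Finset.sum_eq_zero_iff_of_nonneg hnonneg).1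
      (le_antisymm hsum (Finset.sum_nonneg hnonneg)) k (Finset.mem_univ k)
    rw [hquad] at h0
    by_contra hne
    exact (hpos _ (sub_ne_zero.2 hne)).ne' h0
  have hspan : ⊤ ≤ Submodule.span ℝ (Set.range v) := by
    rw [← e.toBasis.span_eq, Submodule.span_le]
    rintro _ ⟨k, rfl⟩
    rw [e.coe_toBasis, hTe k]
    exact Submodule.sum_mem _ fun j _ =>
      Submodule.smul_mem _ _ (Submodule.subset_span ⟨j, rfl⟩)
  have hcard : n ≤ i := by
    have h := finrank_range_le_card (R := ℝ) v
    rw [Set.finrank, top_le_iff.1 hspan, finrank_top] at h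
    simpa using h
  exact hdep (linearIndependent_of_top_le_span_of_card_eq_finrank hspan (by
    simp [le_antisymm hi hcard]))
end

section
/- Let A : ℝⁿ → ℝⁿ be a symmetric positive definite linear map with tr A ≤ 1, and let i < n. Let X ⊂ Y be subspaces of ℝⁿ with dim X = i and dim Y = i + 1. Suppose v : Fin i → ℝⁿ is a family of vectors with v_j ∈ X, ‖A (v j)‖ = 1 for all j, and ⟪A (v j), v_k⟫ = -1 for all j ≠ k. Then the set S = {x ∈ Y : ‖A x‖ = 1 and ⟪A x, v_j⟫ = -1 for all j} has exactly two elements, and every element of S lies outside X (so adjoining it to (v_1, …, v_i) yields a basis of Y). -/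
open scoped RealInnerProductSpace

/-- If `T` is nonnegative on an orthogonal basis of a proper subspace `P` and positive on the
orthogonal complement of `P`, then `T` has positive trace. -/
theorem LinearMap.trace_pos_of_orthogonal_family {F ι : Type*} [NormedAddCommGroup F]
    [InnerProductSpace ℝ F] [FiniteDimensional ℝ F] [Fintype ι] (T : F →ₗ[ℝ] F)
    (P : Submodule ℝ F) (hcard : Fintype.card ι = Module.finrank ℝ P)
    (hlt : Module.finrank ℝ P < Module.finrank ℝ F) (w : ι → F) (hwP : ∀ k, w k ∈ P)
    (hw0 : ∀ k, w k ≠ 0) (hw : Pairwise fun j k => ⟪w j, w k⟫ = 0)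
    (hT : ∀ k, 0 ≤ ⟪w k, T (w k)⟫)
    (hTq : ∀ q, q ≠ 0 → (∀ x ∈ P, ⟪x, q⟫ = 0) → 0 < ⟪q, T q⟫) :
    0 < LinearMap.trace ℝ F T := by
  classical
  have hspan : Submodule.span ℝ (Set.range w) = P := by
    refine Submodule.eq_of_le_of_finrank_eq
      (Submodule.span_le.2 (Set.range_subset_iff.2 hwP)) ?_
    rw [finrank_span_eq_card (linearIndependent_of_ne_zero_of_inner_eq_zero hw0 hw), hcard]
  let m := Module.finrank ℝ F - Fintype.card ι
  let u : ι ⊕ Fin m → F := Sum.elim (fun k => (‖w k‖⁻¹ : ℝ) • w k) 0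
  have hu : Orthonormal ℝ ((Set.range (Sum.inl : ι → ι ⊕ Fin m)).domRestrict u) := by
    constructor
    · rintro ⟨_, k, rfl⟩
      change ‖(‖w k‖⁻¹ : ℝ) • w k‖ = 1
      simp [norm_smul, hw0 k]
    · rintro ⟨_, j, rfl⟩ ⟨_, k, rfl⟩ hjk
      have h : j ≠ k := by
        rintro rfl
        exact hjk rfl
      change ⟪(‖w j‖⁻¹ : ℝ) • w j, (‖w k‖⁻¹ : ℝ) • w k⟫ = 0
      rw [real_inner_smul_left, real_inner_smul_right, hw h, mul_zero, mul_zero]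
  obtain ⟨b, hb⟩ := hu.exists_orthonormalBasis_extension_of_card_eq
    (by simp only [Fintype.card_sum, Fintype.card_fin, m]; omega)
  have hbl : ∀ k, b (Sum.inl k) = (‖w k‖⁻¹ : ℝ) • w k := fun k => hb _ ⟨k, rfl⟩
  have hbr : ∀ l, 0 < ⟪b (Sum.inr l), T (b (Sum.inr l))⟫ := by
    intro l
    refine hTq _ (b.orthonormal.ne_zero _) ?_
    rw [← hspan]
    intro x hx
    induction hx using Submodule.span_induction with
    | mem x hx =>
      obtain ⟨k, rfl⟩ := hx
      have h : ⟪b (Sum.inl k), b (Sum.inr l)⟫ = 0 := b.orthonormal.2 Sum.inl_ne_inr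
      rw [hbl, real_inner_smul_left] at h
      exact (mul_eq_zero.1 h).resolve_left (inv_ne_zero (norm_ne_zero_iff.2 (hw0 k)))
    | zero => simp
    | add x y _ _ hx hy => rw [inner_add_left, hx, hy, add_zero]
    | smul a x _ hx => rw [real_inner_smul_left, hx, mul_zero]
  rw [LinearMap.trace_eq_sum_inner T b, Fintype.sum_sum_type]
  refine add_pos_of_nonneg_of_pos (Finset.sum_nonneg fun k _ => ?_)
    (Finset.sum_pos (fun l _ => hbr l) ⟨⟨0, by omega⟩, Finset.mem_univ _⟩)
  rw [hbl, map_smul, real_inner_smul_left, real_inner_smul_right]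
  have := hT k
  positivity

/-- The inner product `⟪A x, y⟫ + s t` on `E × ℝ` for a positive definite `A`. -/
noncomputable abbrev liftedCore {E : Type*} [NormedAddCommGroup E] [InnerProductSpace ℝ E]
    (A : E →ₗ[ℝ] E) (hsym : ∀ x y, ⟪A x, y⟫ = ⟪x, A y⟫)
    (hpos : ∀ x, x ≠ 0 → 0 < ⟪A x, x⟫) : InnerProductSpace.Core ℝ (E × ℝ) where
  inner p q := ⟪A p.1, q.1⟫ + p.2 * q.2
  conj_inner_symm p q := by
    simp only [conj_trivial]
    rw [hsym, real_inner_comm, mul_comm]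
  re_inner_nonneg p := by
    simp only [RCLike.re_to_real]
    rcases eq_or_ne p.1 0 with h | h
    · simp [h, mul_self_nonneg]
    · exact add_nonneg (hpos _ h).le (mul_self_nonneg _)
  add_left p q r := by
    simp only [Prod.fst_add, Prod.snd_add, map_add, inner_add_left]
    ring
  smul_left p q r := by
    simp only [Prod.smul_fst, Prod.smul_snd, map_smul, real_inner_smul_left, smul_eq_mul,
      conj_trivial]
    ring
  definite p hp := by
    have h1 : p.1 = 0 := by
      by_contra h
      linarith [hpos _ h, mul_self_nonneg p.2]
    have h2 : p.2 = 0 := by simpa [h1] using hp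
    exact Prod.ext h1 h2

/-- The subspace `X × ℝ` has dimension `dim X + 1`. -/
theorem finrank_prod_top {E : Type*} [AddCommGroup E] [Module ℝ E] (X : Submodule ℝ E)
    [FiniteDimensional ℝ X] :
    Module.finrank ℝ (X.prod (⊤ : Submodule ℝ ℝ)) = Module.finrank ℝ X + 1 := by
  have h := LinearMap.finrank_range_of_inj
    (f := X.subtype.prodMap (LinearMap.id : ℝ →ₗ[ℝ] ℝ))
    (X.injective_subtype.prodMap Function.injective_id)
  rwa [LinearMap.range_prodMap, Submodule.range_subtype, LinearMap.range_id,
    Module.finrank_prod, Module.finrank_self] at h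

/-- The indefinite form `‖A x‖ ^ 2 - s ^ 2` is negative on the lifted orthogonal complement, in
`X × ℝ`, of the lifts of vectors on the outer ellipsoid. -/
theorem norm_sq_lt_sq_of_lifted_orthogonal {E : Type*} [NormedAddCommGroup E]
    [InnerProductSpace ℝ E] [FiniteDimensional ℝ E] (A : E →ₗ[ℝ] E)
    (hsym : ∀ x y, ⟪A x, y⟫ = ⟪x, A y⟫) (hpos : ∀ x, x ≠ 0 → 0 < ⟪A x, x⟫)
    (htr : LinearMap.trace ℝ E A ≤ 1) {ι : Type*} [Fintype ι] (X : Submodule ℝ E)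
    (hX : Module.finrank ℝ X = Fintype.card ι) (hlt : Module.finrank ℝ X < Module.finrank ℝ E)
    (v : ι → E) (hvX : ∀ j, v j ∈ X) (hout : ∀ j, ‖A (v j)‖ = 1)
    (horth : ∀ j k, j ≠ k → ⟪A (v j), v k⟫ = -1) (x : E) (s : ℝ) (hx : x ∈ X)
    (hne : (x, s) ≠ 0) (hxv : ∀ j, ⟪A x, v j⟫ = -s) : ‖A x‖ ^ 2 < s ^ 2 := by
  by_contra! hle
  let T : E × ℝ →ₗ[ℝ] E × ℝ := A.prodMap (-LinearMap.id)
  have htrT : LinearMap.trace ℝ (E × ℝ) T ≤ 0 := by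
    rw [LinearMap.trace_prodMap', map_neg, LinearMap.trace_id]
    simpa using htr
  have hAA : ∀ y, ⟪A y, A y⟫ = ‖A y‖ ^ 2 := fun y => real_inner_self_eq_norm_sq _
  have hP := finrank_prod_top X
  let c := liftedCore A hsym hpos
  refine htrT.not_gt (@LinearMap.trace_pos_of_orthogonal_family (E × ℝ) (Option ι)
    c.toNormedAddCommGroup (InnerProductSpace.ofCore c.toCore) inferInstance _ T
    (X.prod ⊤) ?_ ?_ (fun k => k.elim (x, s) fun j => (v j, 1)) ?_ ?_ ?_ ?_ ?_)
  · rw [hP, hX, Fintype.card_option]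
  · rw [hP, Module.finrank_prod, Module.finrank_self]
    omega
  · rintro (_ | j)
    · exact ⟨hx, trivial⟩
    · exact ⟨hvX j, trivial⟩
  · rintro (_ | j)
    · exact hne
    · exact fun h => one_ne_zero (congrArg Prod.snd h)
  · rintro (_ | j) (_ | k) hjk
    · exact absurd rfl hjk
    · change ⟪A x, v k⟫ + s * 1 = 0
      rw [hxv]; ring
    · change ⟪A (v j), x⟫ + 1 * s = 0
      rw [hsym, real_inner_comm, hxv]; ring
    · change ⟪A (v j), v k⟫ + 1 * 1 = 0
      rw [horth j k fun h => hjk (congrArg some h)]; ring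
  · rintro (_ | j)
    · change 0 ≤ ⟪A x, A x⟫ + s * -s
      rw [hAA]; linarith
    · change 0 ≤ ⟪A (v j), A (v j)⟫ + 1 * -1
      rw [hAA, hout]; norm_num
  · rintro ⟨y, t⟩ hq hqP
    have ht : t = 0 := by
      have h : ⟪A 0, y⟫ + 1 * t = 0 := hqP (0, 1) ⟨X.zero_mem, trivial⟩
      simpa using h
    subst ht
    change 0 < ⟪A y, A y⟫ + 0 * -0
    have hy : y ≠ 0 := fun h => hq (by rw [h]; rfl)
    have hAy : A y ≠ 0 := fun h => by simpa [h] using hpos y hy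
    rw [hAA]
    have := norm_pos_iff.2 hAy
    nlinarith

/-- A subspace of dimension exceeding the number of given linear conditions contains a nonzero
solution of them. -/
theorem Submodule.exists_ne_zero_forall_eq_zero {K V ι : Type*} [Field K] [AddCommGroup V]
    [Module K V] [Fintype ι] (P : Submodule K V) [FiniteDimensional K P] (φ : ι → V →ₗ[K] K)
    (h : Fintype.card ι < Module.finrank K P) : ∃ p ∈ P, p ≠ 0 ∧ ∀ k, φ k p = 0 := by
  have hker := LinearMap.ker_ne_bot_of_finrank_lt (f := (LinearMap.pi φ).domRestrict P)
    (by simpa using h)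
  obtain ⟨p, hp, hp0⟩ := Submodule.exists_mem_ne_zero_of_ne_bot hker
  exact ⟨p, p.2, fun h => hp0 (Subtype.ext h), fun k => congrFun hp k⟩

/-- A real quadratic with positive leading and negative constant coefficient has exactly two
roots. -/
theorem exists_two_roots_quadratic {a b c : ℝ} (ha : 0 < a) (hc : c < 0) :
    ∃ t₁ t₂ : ℝ, t₁ ≠ t₂ ∧ ∀ t, a * (t * t) + b * t + c = 0 ↔ t = t₁ ∨ t = t₂ := by
  have hd : 0 < discrim a b c := by
    unfold discrim
    nlinarith [sq_nonneg b, mul_pos ha (neg_pos.2 hc)]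
  have hs := Real.sqrt_pos.2 hd
  refine ⟨_, _, ?_, fun t => quadratic_eq_zero_iff ha.ne' (Real.mul_self_sqrt hd.le).symm t⟩
  intro h
  rw [div_left_inj' (by positivity)] at h
  linarith

/-- Adjusted orthogonalization step: with `tr A ≤ 1`, subspaces `X ⊂ Y` of dimensions `i` and
`i+1`, and vectors `v₁, …, vᵢ ∈ X` on the outer ellipsoid with pairwise `Â`-orthogonal lifts,
there are exactly two vectors `x ∈ Y` on the outer ellipsoid whose lift is `Â`-orthogonal to
all lifts `(vⱼ, 1)`; each of them lies outside `X`. -/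
theorem adjusted_orthogonalization_step {n : ℕ}
    (A : EuclideanSpace ℝ (Fin n) →ₗ[ℝ] EuclideanSpace ℝ (Fin n))
    (hsym : ∀ x y, ⟪A x, y⟫ = ⟪x, A y⟫)
    (hpos : ∀ x, x ≠ 0 → 0 < ⟪A x, x⟫)
    (htr : LinearMap.trace ℝ (EuclideanSpace ℝ (Fin n)) A ≤ 1)
    (i : ℕ) (hi : i < n)
    (X Y : Submodule ℝ (EuclideanSpace ℝ (Fin n)))
    (hXY : X ≤ Y)
    (hX : Module.finrank ℝ X = i) (hY : Module.finrank ℝ Y = i + 1)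
    (v : Fin i → EuclideanSpace ℝ (Fin n))
    (hvX : ∀ j, v j ∈ X)
    (hout : ∀ j, ‖A (v j)‖ = 1)
    (horth : ∀ j k, j ≠ k → ⟪A (v j), v k⟫ = -1) :
    (∃ x x' : EuclideanSpace ℝ (Fin n), x ≠ x' ∧
      {x : EuclideanSpace ℝ (Fin n) |
        x ∈ Y ∧ ‖A x‖ = 1 ∧ ∀ j, ⟪A x, v j⟫ = -1} = {x, x'}) ∧
    ∀ x : EuclideanSpace ℝ (Fin n),
      x ∈ Y → ‖A x‖ = 1 → (∀ j, ⟪A x, v j⟫ = -1) → x ∉ X := by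
  have key := norm_sq_lt_sq_of_lifted_orthogonal A hsym hpos htr X (by simpa using hX)
    (by simpa [hX] using hi) v hvX hout horth
  have hzero : ∀ y ∈ X, (∀ j, ⟪A y, v j⟫ = 0) → y = 0 := by
    intro y hy hyv
    by_contra h
    have := key y 0 hy (fun h' => h (congrArg Prod.fst h')) (by simpa using hyv)
    nlinarith [sq_nonneg ‖A y‖]
  have hone : ∀ y ∈ X, (∀ j, ⟪A y, v j⟫ = -1) → ‖A y‖ ^ 2 < 1 := fun y hy hyv => by
    simpa using key y 1 hy (fun h => one_ne_zero (congrArg Prod.snd h)) hyv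
  let φ : Fin i → EuclideanSpace ℝ (Fin n) →ₗ[ℝ] ℝ := fun j => (innerₗ _ (v j)).comp A
  have hφ : ∀ j x, φ j x = ⟪A x, v j⟫ := fun j x => real_inner_comm (A x) (v j)
  obtain ⟨z, hzX, hzv⟩ : ∃ z ∈ X, ∀ j, ⟪A z, v j⟫ = -1 := by
    obtain ⟨⟨x, s⟩, ⟨hx, -⟩, hne, hxs⟩ :=
      (X.prod (⊤ : Submodule ℝ ℝ)).exists_ne_zero_forall_eq_zero
        (fun j => (φ j).coprod LinearMap.id) (by rw [finrank_prod_top, hX]; simp)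
    have hxv : ∀ j, ⟪A x, v j⟫ = -s := fun j => by
      have h : φ j x + s = 0 := hxs j
      rw [hφ] at h
      linarith
    have hs : s ≠ 0 := by
      rintro rfl
      nlinarith [key x 0 hx hne hxv, sq_nonneg ‖A x‖]
    refine ⟨s⁻¹ • x, X.smul_mem _ hx, fun j => ?_⟩
    rw [map_smul, real_inner_smul_left, hxv]
    field_simp
  obtain ⟨f, hfY, hf0, hfv⟩ := Y.exists_ne_zero_forall_eq_zero φ (by simp [hY])
  simp only [hφ] at hfv
  have hfX : f ∉ X := fun h => hf0 (hzero f h hfv)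
  have hsup : X ⊔ Submodule.span ℝ {f} = Y := by
    refine Submodule.eq_of_le_of_finrank_le
      (sup_le hXY ((Submodule.span_singleton_le_iff_mem _ _).2 hfY)) ?_
    have hlt : X < X ⊔ Submodule.span ℝ {f} :=
      lt_of_le_of_ne le_sup_left fun h =>
        hfX (h ▸ Submodule.mem_sup_right (Submodule.mem_span_singleton_self f))
    have := Submodule.finrank_lt_finrank_of_lt hlt
    omega
  have hline : ∀ x, (x ∈ Y ∧ ∀ j, ⟪A x, v j⟫ = -1) ↔ ∃ t : ℝ, x = z + t • f := by
    intro x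
    constructor
    · rintro ⟨hxY, hxv⟩
      rw [← hsup] at hxY
      obtain ⟨y, hy, g, hg, rfl⟩ := Submodule.mem_sup.1 hxY
      obtain ⟨t, rfl⟩ := Submodule.mem_span_singleton.1 hg
      refine ⟨t, ?_⟩
      have h := hzero (y - z) (X.sub_mem hy hzX) fun j => by
        have := hxv j
        rw [map_add, map_smul, inner_add_left, real_inner_smul_left, hfv] at this
        rw [map_sub, inner_sub_left, hzv]
        linarith
      rw [sub_eq_zero.1 h]
    · rintro ⟨t, rfl⟩
      refine ⟨Y.add_mem (hXY hzX) (Y.smul_mem _ hfY), fun j => ?_⟩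
      rw [map_add, map_smul, inner_add_left, real_inner_smul_left, hfv, hzv]
      ring
  have hAf : A f ≠ 0 := fun h => by simpa [h] using hpos f hf0
  obtain ⟨t₁, t₂, ht, hroots⟩ := exists_two_roots_quadratic (a := ‖A f‖ ^ 2)
    (b := 2 * ⟪A z, A f⟫) (c := ‖A z‖ ^ 2 - 1) (by have := norm_pos_iff.2 hAf; positivity)
    (by linarith [hone z hzX hzv])
  have hnorm : ∀ t : ℝ, ‖A (z + t • f)‖ = 1 ↔ t = t₁ ∨ t = t₂ := by
    intro t
    rw [← hroots, ← pow_eq_one_iff_of_nonneg (norm_nonneg _) two_ne_zero, map_add, map_smul,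
      norm_add_sq_real, norm_smul, real_inner_smul_right, mul_pow, Real.norm_eq_abs, sq_abs]
    constructor <;> intro h <;> linarith
  refine ⟨⟨z + t₁ • f, z + t₂ • f, ?_, ?_⟩, ?_⟩
  · exact fun h => ht (smul_left_injective ℝ hf0 (add_left_cancel h))
  · ext x
    simp only [Set.mem_ofPred_eq, Set.mem_insert_iff, Set.mem_singleton_iff]
    constructor
    · rintro ⟨hxY, hx1, hxv⟩
      obtain ⟨t, rfl⟩ := (hline x).1 ⟨hxY, hxv⟩
      rcases (hnorm t).1 hx1 with rfl | rfl
      · exact Or.inl rfl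
      · exact Or.inr rfl
    · rintro (rfl | rfl)
      · have h := (hline _).2 ⟨t₁, rfl⟩
        exact ⟨h.1, (hnorm _).2 (Or.inl rfl), h.2⟩
      · have h := (hline _).2 ⟨t₂, rfl⟩
        exact ⟨h.1, (hnorm _).2 (Or.inr rfl), h.2⟩
  · intro x _ hx1 hxv hxX
    have := hone x hxX hxv
    rw [hx1] at this
    norm_num at this
end
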